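/- For every integer n ≥ 2, the Harary indices of the graphs G_{n,k} are strictly decreasing in k: H(K_n) = H(G_{n,0}) > H(G_{n,1}) > H(G_{n,2}) > ⋯ > H(G_{n,n−2}) = H(P_n), i.e., H(G_{n,k−1}) > H(G_{n,k}) for all 1 ≤ k ≤ n − 2, where G_{n,0} = K_n and G_{n,n−2} is the path P_n on n vertices. -/

import Mathlib

open SimpleGraph

/-- The Harary index of a finite simple graph: sum of reciprocals of distances over
unordered pairs of distinct vertices (pairs at infinite distance contribute `0`,
since `SimpleGraph.dist` is `0` there and `1/0 = 0` in `ℝ`). -/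
noncomputable def hararyIndex {V : Type*} [Fintype V] (G : SimpleGraph V) : ℝ :=
  (∑ u : V, ∑ v : V, (1 : ℝ) / (G.dist u v)) / 2

/-- The clique vertex "owning" vertex `j` of `GNK n k`: the first `n - k` vertices form
the clique `K_{n-k}`, and the remaining `k` vertices are distributed round-robin among
the clique vertices, forming pendant paths of almost equal lengths. -/
def gnkOwner (n k j : ℕ) : ℕ := if j < n - k then j else (j - (n - k)) % (n - k)

/-- The distance of vertex `j` of `GNK n k` from its owning clique vertex along the
attached pendant path. -/
def gnkDepth (n k j : ℕ) : ℕ := if j < n - k then 0 else (j - (n - k)) / (n - k) + 1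

/-- The graph `G_{n,k}` on `n` vertices: obtained from `K_{n-k}` by attaching pendant
paths of almost equal lengths (`k` new vertices in total, distributed round-robin) at
its `n - k` vertices. -/
def GNK (n k : ℕ) : SimpleGraph (Fin n) :=
  SimpleGraph.fromRel (fun a b =>
    (gnkDepth n k a = 0 ∧ gnkDepth n k b = 0) ∨
    (gnkOwner n k a = gnkOwner n k b ∧ gnkDepth n k a + 1 = gnkDepth n k b))

/-- A vertex is a cut vertex if deleting it increases the number of connected
components. -/
def IsCutVertex {V : Type*} [Fintype V] (G : SimpleGraph V) (v : V) : Prop :=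
  Nat.card G.ConnectedComponent <
    Nat.card (G.induce ({v}ᶜ : Set V)).ConnectedComponent

/-- The distance function of the pendant-path graph with clique size `m`. -/
def gd (m a b : ℕ) : ℕ :=
  if a % m = b % m then (a / m - b / m) + (b / m - a / m) else a / m + b / m + 1

/-- Distances from a last vertex `N`, sorted. -/
def sd (m N i : ℕ) : ℕ :=
  if i < N / m then i + 1 else N / m + 1 + (i - N / m) / (m - 1)

lemma gnkOwner_eq (n k j : ℕ) : gnkOwner n k j = j % (n - k) := by
  unfold gnkOwner
  split_ifs with h
  · exact (Nat.mod_eq_of_lt h).symm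
  · exact (Nat.mod_eq_sub_mod (by omega)).symm

lemma gnkDepth_eq (n k j : ℕ) (hm : 0 < n - k) : gnkDepth n k j = j / (n - k) := by
  unfold gnkDepth
  split_ifs with h
  · exact (Nat.div_eq_of_lt h).symm
  · exact (Nat.div_eq_sub_div hm (by omega)).symm

lemma dist_eq_of_potential {V : Type*} (G : SimpleGraph V) (b : V) (f : V → ℕ)
    (h0 : f b = 0) (h1 : ∀ a, f a = 0 → a = b)
    (hL : ∀ a c, G.Adj a c → f a ≤ f c + 1)
    (hS : ∀ a t, f a = t + 1 → ∃ c, G.Adj a c ∧ f c = t) (a : V) :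
    G.dist a b = f a := by
  have hw : ∀ t a, f a = t → ∃ p : G.Walk a b, p.length = t := by
    intro t
    induction t with
    | zero =>
      intro a ha
      obtain rfl := h1 a ha
      exact ⟨Walk.nil, rfl⟩
    | succ t ih =>
      intro a ha
      obtain ⟨c, hc, hct⟩ := hS a t ha
      obtain ⟨p, hp⟩ := ih c hct
      exact ⟨Walk.cons hc p, by simp [hp]⟩
  have hl : ∀ a (p : G.Walk a b), f a ≤ p.length := by
    intro a p
    induction p with
    | nil => simp [h0]
    | cons h p ih =>
      have := hL _ _ h
      have := ih h0 h1 hw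
      simp only [Walk.length_cons]
      omega
  obtain ⟨p, hp⟩ := hw (f a) a rfl
  apply le_antisymm
  · rw [← hp]; exact dist_le p
  · obtain ⟨q, hq⟩ := (Walk.reachable p).exists_walk_length_eq_dist
    rw [← hq]; exact hl a q

lemma GNK_adj (n k : ℕ) (hm : 0 < n - k) (a b : Fin n) :
    (GNK n k).Adj a b ↔ a ≠ b ∧ ((a.1 / (n-k) = 0 ∧ b.1 / (n-k) = 0) ∨
      (a.1 % (n-k) = b.1 % (n-k) ∧
        (a.1 / (n-k) + 1 = b.1 / (n-k) ∨ b.1 / (n-k) + 1 = a.1 / (n-k)))) := by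
  simp only [GNK, fromRel_adj, gnkOwner_eq, gnkDepth_eq _ _ _ hm]
  constructor
  · rintro ⟨h, h'⟩; refine ⟨h, ?_⟩; omega
  · rintro ⟨h, h'⟩; refine ⟨h, ?_⟩; omega

lemma gd_self (m a : ℕ) : gd m a a = 0 := by simp [gd]

lemma gd_comm (m a b : ℕ) : gd m a b = gd m b a := by
  unfold gd
  split_ifs <;> omega

lemma eq_of_div_mod {m a b : ℕ} (h : a / m = b / m) (h' : a % m = b % m) : a = b := by
  rw [← Nat.div_add_mod a m, ← Nat.div_add_mod b m, h, h']

lemma GNK_dist (n k : ℕ) (hm : 0 < n - k) (a b : Fin n) :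
    (GNK n k).dist a b = gd (n-k) a b := by
  apply dist_eq_of_potential (GNK n k) b (fun a => gd (n-k) a b)
  · exact gd_self _ _
  · intro a ha
    simp only [gd] at ha
    split_ifs at ha with h
    exact Fin.ext (eq_of_div_mod (m := n - k) (by omega) h)
  · intro a c h
    obtain ⟨-, h⟩ := (GNK_adj n k hm a c).1 h
    simp only [gd]
    generalize a.1 / (n - k) = x at *
    generalize c.1 / (n - k) = y at *
    generalize b.1 / (n - k) = z at *
    split_ifs <;> omega
  · intro a t h
    simp only [gd] at h
    simp only [GNK_adj n k hm]
    generalize n - k = m at *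
    have ea := Nat.div_add_mod a.1 m
    have eb := Nat.div_add_mod b.1 m
    have down : 0 < a.1 / m → (a.1 - m) / m + 1 = a.1 / m ∧ (a.1 - m) % m = a.1 % m := by
      intro h0
      have : m ≤ a.1 := by
        by_contra hc
        rw [Nat.div_eq_of_lt (by omega)] at h0
        omega
      exact ⟨by rw [Nat.div_eq_sub_div hm this], (Nat.mod_eq_sub_mod this).symm⟩
    have ha := a.2
    have hb := b.2
    have useDown : 0 < a.1 / m → (a.1 % m = b.1 % m → b.1 / m < a.1 / m) →
        ∃ c : Fin n, (a ≠ c ∧ ((a.1 / m = 0 ∧ c.1 / m = 0) ∨ (a.1 % m = c.1 % m ∧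
        (a.1 / m + 1 = c.1 / m ∨ c.1 / m + 1 = a.1 / m)))) ∧ gd m c b = t := by
      intro h0 h1
      obtain ⟨d1, d2⟩ := down h0
      refine ⟨⟨a.1 - m, by omega⟩, ⟨?_, Or.inr ⟨d2.symm, Or.inr d1⟩⟩, ?_⟩
      · intro hc
        rw [Fin.ext_iff] at hc
        simp only at hc
        rw [← hc] at d1
        omega
      · simp only [gd, d2]
        split_ifs at h ⊢ <;> omega
    by_cases ho : a.1 % m = b.1 % m
    · rw [if_pos ho] at h
      by_cases hlt : b.1 / m < a.1 / m
      · exact useDown (Nat.zero_lt_of_lt hlt) (fun _ => hlt)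
      · have h2 : a.1 / m + 1 ≤ b.1 / m := by omega
        have h3 : m * (a.1 / m + 1) ≤ m * (b.1 / m) := Nat.mul_le_mul_left _ h2
        rw [mul_add, mul_one] at h3
        have e1 : (a.1 + m) / m = a.1 / m + 1 := Nat.add_div_right _ hm
        have e2 : (a.1 + m) % m = a.1 % m := Nat.add_mod_right _ _
        refine ⟨⟨a.1 + m, by omega⟩, ⟨?_, Or.inr ⟨e2.symm, Or.inl e1.symm⟩⟩, ?_⟩
        · intro hc
          rw [Fin.ext_iff] at hc
          simp only at hc
          omega
        · simp only [gd, e1, e2, if_pos ho]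
          clear useDown down e1 e2 h3 ea eb
          generalize a.1 / m = x at *
          generalize b.1 / m = y at *
          omega
    · by_cases h0 : 0 < a.1 / m
      · exact useDown h0 (fun h => absurd h ho)
      · have hlt := Nat.mod_lt b.1 hm
        have e1 : (b.1 % m) / m = 0 := Nat.div_eq_of_lt hlt
        have e2 : (b.1 % m) % m = b.1 % m := Nat.mod_mod _ _
        refine ⟨⟨b.1 % m, lt_of_le_of_lt (Nat.mod_le _ _) hb⟩, ⟨?_, Or.inl ⟨Nat.eq_zero_of_not_pos h0, e1⟩⟩, ?_⟩
        · intro hc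
          apply ho
          rw [hc]
          exact e2
        · simp only [gd, e1, e2]
          rw [if_neg ho, Nat.eq_zero_of_not_pos h0] at h
          simp only [if_true]
          clear useDown down ea eb e1 e2
          generalize b.1 / m = y at *
          omega

lemma path_dist (n : ℕ) (a b : Fin n) :
    (pathGraph n).dist a b = (a.1 - b.1) + (b.1 - a.1) := by
  apply dist_eq_of_potential (pathGraph n) b (fun a => (a.1 - b.1) + (b.1 - a.1))
  · simp
  · intro a ha
    apply Fin.ext
    omega
  · intro a c h
    rw [pathGraph_adj] at h
    omega
  · intro a t h
    have ha := a.2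
    have hb := b.2
    simp only [pathGraph_adj]
    by_cases hlt : b.1 < a.1
    · exact ⟨⟨a.1 - 1, by omega⟩, Or.inr (Nat.sub_add_cancel (by omega)), by simp only; omega⟩
    · exact ⟨⟨a.1 + 1, by omega⟩, Or.inl rfl, by simp only; omega⟩

lemma harary_eq (n : ℕ) (G : SimpleGraph (Fin n)) (d : ℕ → ℕ → ℕ)
    (hd : ∀ a b : Fin n, G.dist a b = d a b) (h0 : ∀ a, d a a = 0)
    (hs : ∀ a b, d a b = d b a) :
    hararyIndex G = ∑ v ∈ Finset.range n, ∑ j ∈ Finset.range v, (1 : ℝ) / d j v := by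
  have key : ∀ N : ℕ, ∑ u ∈ Finset.range N, ∑ v ∈ Finset.range N, (1 : ℝ) / d u v
      = 2 * ∑ v ∈ Finset.range N, ∑ j ∈ Finset.range v, (1 : ℝ) / d j v := by
    intro N
    induction N with
    | zero => simp
    | succ N ih =>
      simp only [Finset.sum_range_succ, Finset.sum_add_distrib]
      rw [ih, h0 N]
      have : ∑ x ∈ Finset.range N, (1 : ℝ) / d N x = ∑ x ∈ Finset.range N, (1 : ℝ) / d x N :=
        Finset.sum_congr rfl (fun x _ => by rw [hs])
      rw [this]
      simp
      ring
  unfold hararyIndex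
  simp only [hd]
  rw [Fin.sum_univ_eq_sum_range (fun u => ∑ v : Fin n, (1 : ℝ) / d u v) n]
  have : ∀ u, ∑ v : Fin n, (1 : ℝ) / d u v = ∑ v ∈ Finset.range n, (1 : ℝ) / d u v :=
    fun u => Fin.sum_univ_eq_sum_range (fun v => (1 : ℝ) / d u v) n
  simp only [this, key]
  ring

/-- The rank of vertex `j` among the vertices before `N`, sorted by distance to `N`. -/
def rk (m N j : ℕ) : ℕ :=
  if j % m = N % m then N / m - j / m - 1
  else N / m + ((j / m) * (m - 1) + if j % m < N % m then j % m else j % m - 1)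

lemma rk_aux (m N j : ℕ) (hm : 2 ≤ m) (ho : j % m ≠ N % m) :
    (if j % m < N % m then j % m else j % m - 1) < m - 1 := by
  have := Nat.mod_lt j (show m > 0 by omega)
  have := Nat.mod_lt N (show m > 0 by omega)
  split_ifs <;> omega

lemma lt_of_same {m N j : ℕ} (hj : j < N) (ho : j % m = N % m) : j / m < N / m := by
  have h1 := Nat.div_add_mod j m
  have h2 := Nat.div_add_mod N m
  by_contra hc
  have := Nat.mul_le_mul_left m (not_lt.1 hc)
  omega

lemma sd_rk (m N j : ℕ) (hm : 2 ≤ m) (hj : j < N) : sd m N (rk m N j) = gd m j N := by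
  unfold sd rk gd
  have p1 := Nat.zero_le (j / m)
  generalize hjm : j / m = e at *
  by_cases ho : j % m = N % m
  · have := lt_of_same hj ho
    rw [hjm] at this
    generalize N / m = q at *
    simp only [if_pos ho]
    rw [if_pos (by omega)]
    omega
  · have h := rk_aux m N j hm ho
    simp only [if_neg ho]
    rw [if_neg (by omega), Nat.add_sub_cancel_left, mul_comm e,
      Nat.mul_add_div (by omega), Nat.div_eq_of_lt h]
    omega

lemma rk_lt (m N j : ℕ) (hm : 2 ≤ m) (hj : j < N) : rk m N j < N := by
  unfold rk
  have h1 := Nat.div_add_mod j m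
  have h2 := Nat.div_add_mod N m
  have hq : N / m ≤ N := Nat.div_le_self _ _
  by_cases ho : j % m = N % m
  · rw [if_pos ho]
    have := lt_of_same hj ho
    generalize j / m = e at *
    generalize N / m = q at *
    omega
  · have h := rk_aux m N j hm ho
    rw [if_neg ho]
    obtain ⟨p, rfl⟩ : ∃ p, m = p + 1 := ⟨m - 1, by omega⟩
    have hle : j / (p+1) ≤ N / (p+1) := Nat.div_le_div_right hj.le
    generalize j / (p+1) = e at *
    generalize N / (p+1) = q at *
    rw [Nat.add_sub_cancel] at *
    rcases Nat.lt_or_ge e q with hlt | hge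
    · have : (e + 1) * p ≤ q * p := Nat.mul_le_mul_right _ hlt
      generalize (if j % (p + 1) < N % (p + 1) then j % (p + 1) else j % (p + 1) - 1) = x at *
      have := Nat.zero_le (N % (p + 1))
      rw [add_mul] at h1 h2
      nlinarith
    · obtain rfl : e = q := by omega
      rw [if_pos (by omega)]
      nlinarith

lemma rk_inj (m N i j : ℕ) (hm : 2 ≤ m) (hi : i < N) (hj : j < N)
    (h : rk m N i = rk m N j) : i = j := by
  have hd : gd m i N = gd m j N := by rw [← sd_rk m N i hm hi, ← sd_rk m N j hm hj, h]
  have hi1 : i % m = N % m → i / m < N / m := lt_of_same hi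
  have hj1 : j % m = N % m → j / m < N / m := lt_of_same hj
  have hcl : i / m = j / m → i % m = j % m → i = j := eq_of_div_mod
  unfold gd at hd
  unfold rk at h
  generalize i / m = e at *
  generalize j / m = e' at *
  generalize N / m = q at *
  by_cases ho : i % m = N % m
  · by_cases ho' : j % m = N % m
    · have := hi1 ho
      have := hj1 ho'
      rw [if_pos ho, if_pos ho'] at hd
      exact hcl (by omega) (by omega)
    · have := hi1 ho
      rw [if_pos ho, if_neg ho'] at hd
      omega
  · by_cases ho' : j % m = N % m
    · have := hj1 ho'
      rw [if_neg ho, if_pos ho'] at hd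
      omega
    · rw [if_neg ho, if_neg ho'] at hd h
      have he : e = e' := by omega
      rw [he] at h
      refine hcl he ?_
      split_ifs at h <;> omega

lemma sum_gd (m N : ℕ) (hm : 2 ≤ m) :
    ∑ j ∈ Finset.range N, (1 : ℝ) / gd m j N = ∑ i ∈ Finset.range N, (1 : ℝ) / sd m N i := by
  have hinj : Set.InjOn (rk m N) (Finset.range N : Set ℕ) := by
    intro i hi j hj h
    simp only [Finset.coe_range, Set.mem_Iio] at hi hj
    exact rk_inj m N i j hm hi hj h
  have himg : (Finset.range N).image (rk m N) = Finset.range N := by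
    apply Finset.eq_of_subset_of_card_le
    · intro x hx
      simp only [Finset.mem_image, Finset.mem_range] at hx ⊢
      obtain ⟨j, hj, rfl⟩ := hx
      exact rk_lt m N j hm hj
    · rw [Finset.card_image_of_injOn hinj]
  conv_rhs => rw [← himg]
  rw [Finset.sum_image hinj]
  apply Finset.sum_congr rfl
  intro j hj
  rw [sd_rk m N j hm (Finset.mem_range.1 hj)]

lemma sd_pos (m N i : ℕ) : 0 < sd m N i := by
  unfold sd
  split_ifs
  · omega
  · positivity

lemma sd_mono (m N i : ℕ) (hm : 2 ≤ m) : sd (m + 1) N i ≤ sd m N i := by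
  unfold sd
  have hq : N / (m+1) ≤ N / m := Nat.div_le_div_left (by omega) (by omega)
  generalize N / (m+1) = q' at *
  generalize N / m = q at *
  rw [Nat.add_sub_cancel]
  split_ifs with h1 h2 h2
  · omega
  · omega
  · have := Nat.div_le_self (i - q') m
    omega
  · have e1 : (i - q') / m ≤ ((i - q) + m * (q - q')) / m := by
      apply Nat.div_le_div_right
      have : 1 * (q - q') ≤ m * (q - q') := Nat.mul_le_mul_right _ (by omega)
      omega
    rw [Nat.add_mul_div_left _ _ (by omega)] at e1
    have e2 : (i - q) / m ≤ (i - q) / (m - 1) := Nat.div_le_div_left (by omega) (by omega)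
    omega

lemma harary_GNK (n k : ℕ) (hm : 2 ≤ n - k) : hararyIndex (GNK n k) =
    ∑ v ∈ Finset.range n, ∑ i ∈ Finset.range v, (1 : ℝ) / sd (n - k) v i := by
  rw [harary_eq n (GNK n k) (gd (n-k)) (GNK_dist n k (by omega)) (gd_self _) (gd_comm _)]
  exact Finset.sum_congr rfl (fun v _ => sum_gd _ _ hm)

/-- The Harary indices of the graphs `G_{n,k}` are strictly decreasing in `k`:
`H(K_n) = H(G_{n,0}) > H(G_{n,1}) > ⋯ > H(G_{n,n-2}) = H(P_n)`. -/
theorem harary_GNK_strictAnti (n : ℕ) (hn : 2 ≤ n) :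
    hararyIndex (GNK n 0) = hararyIndex (⊤ : SimpleGraph (Fin n)) ∧
    hararyIndex (GNK n (n - 2)) = hararyIndex (SimpleGraph.pathGraph n) ∧
    ∀ k, 1 ≤ k → k ≤ n - 2 →
      hararyIndex (GNK n k) < hararyIndex (GNK n (k - 1)) := by
  refine ⟨?_, ?_, ?_⟩
  · congr 1
    ext a b
    rw [GNK_adj n 0 (by omega), top_adj]
    simp only [Nat.sub_zero, Nat.div_eq_of_lt a.2, Nat.div_eq_of_lt b.2]
    simp
  · rw [harary_GNK n (n-2) (by omega),
      harary_eq n (pathGraph n) (fun a b => (a - b) + (b - a)) (path_dist n) (by simp)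
        (fun a b => by omega)]
    rw [show n - (n - 2) = 2 by omega]
    refine Finset.sum_congr rfl (fun v _ => ?_)
    rw [← Finset.sum_range_reflect]
    refine Finset.sum_congr rfl (fun i hi => ?_)
    have hi := Finset.mem_range.1 hi
    congr 2
    unfold sd
    split_ifs
    · omega
    · simp only [Nat.add_one_sub_one, Nat.div_one]
      omega
  · intro k hk hk2
    rw [harary_GNK n k (by omega), harary_GNK n (k-1) (by omega),
      show n - (k - 1) = n - k + 1 by omega]
    have hm : 2 ≤ n - k := by omega
    have hmn : n - k < n := by omega
    generalize n - k = m at *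
    have hterm : ∀ v i, (1 : ℝ) / sd m v i ≤ 1 / sd (m+1) v i := by
      intro v i
      apply one_div_le_one_div_of_le
      · exact_mod_cast sd_pos _ _ _
      · exact_mod_cast sd_mono _ _ _ hm
    apply Finset.sum_lt_sum
    · intro v _
      exact Finset.sum_le_sum (fun i _ => hterm v i)
    · refine ⟨m, Finset.mem_range.2 hmn, ?_⟩
      apply Finset.sum_lt_sum
      · intro i _
        exact hterm m i
      · refine ⟨1, Finset.mem_range.2 (by omega), ?_⟩
        have e1 : m / m = 1 := Nat.div_self (by omega)
        have e2 : m / (m+1) = 0 := Nat.div_eq_of_lt (by omega)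
        have e3 : 1 / m = 0 := Nat.div_eq_of_lt (by omega)
        have h1 : sd m m 1 = 2 := by simp [sd, e1]
        have h2 : sd (m+1) m 1 = 1 := by
          simp only [sd, e2, Nat.add_sub_cancel, Nat.sub_zero, e3]
          simp
        rw [h1, h2]
        norm_num
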